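/- arXiv:2601.22016 — 2 statements merged into one kernel-verified Lean document; each statement's English description precedes it below -/
import Mathlib

section
/- Let X be a nonempty finite set, f : X → [0,1], and let D_1, …, D_K be nonempty pairwise disjoint subsets of X whose union is X. Fix thresholds α, β ∈ [0,1], a positive integer N, and δ ∈ (0,1). For each j draw N independent uniform samples from D_j (all KN draws mutually independent) and let f̂_j be the empirical mean of f over the samples from D_j. Define X_keep = ⋃ { D_j : f̂_j ≥ 1−β } and X_disc = ⋃ { D_j : f̂_j ≤ α }. Then with probability at least 1 − δ, if X_keep is nonempty then f̄(X_keep) ≥ 1 − β − √(log(2K/δ)/(2N)), and if X_disc is nonempty then f̄(X_disc) ≤ α + √(log(2K/δ)/(2N)). -/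
open MeasureTheory

lemma aux_integral {γ : Type*} [MeasurableSpace γ] [DiscreteMeasurableSpace γ]
    (s : Finset γ) (hs : s.Nonempty) (g : γ → ℝ)
    (hg : Integrable g (PMF.uniformOfFinset s hs).toMeasure) :
    ∫ x, g x ∂(PMF.uniformOfFinset s hs).toMeasure = (∑ x ∈ s, g x) / s.card := by
  rw [PMF.integral_eq_tsum _ _ hg, tsum_eq_sum (s := s)]
  · rw [Finset.sum_div]
    refine Finset.sum_congr rfl fun x hx => ?_
    rw [PMF.uniformOfFinset_apply_of_mem hs hx]
    simp [div_eq_inv_mul]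
  · intro x hx
    rw [PMF.uniformOfFinset_apply_of_notMem hs hx]
    simp

lemma aux_hoeff {γ : Type*} [MeasurableSpace γ] [DiscreteMeasurableSpace γ]
    (K N : ℕ) (hN : 0 < N) (D : Fin K → Finset γ) (hD : ∀ j, (D j).Nonempty)
    (g : γ → ℝ) (l u : ℝ) (hlu : u - l = 1) (hg : ∀ j, ∀ x ∈ D j, g x ∈ Set.Icc l u)
    (j : Fin K) (ε : ℝ) (hε : 0 ≤ ε) :
    (Measure.pi fun p : Fin K × Fin N =>
        (PMF.uniformOfFinset (D p.1) (hD p.1)).toMeasure).real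
      {ω | (∑ x ∈ D j, g x) / (D j).card + ε ≤ (∑ i : Fin N, g (ω (j, i))) / N}
      ≤ Real.exp (-(2 * N * ε ^ 2)) := by
  set μ : Fin K × Fin N → Measure γ := fun p =>
    (PMF.uniformOfFinset (D p.1) (hD p.1)).toMeasure with hμ
  have hprob : ∀ p, IsProbabilityMeasure (μ p) := fun p => by rw [hμ]; infer_instance
  have hmeas : Measurable g := Measurable.of_discrete
  have hae : ∀ p, ∀ᵐ x ∂(μ p), g x ∈ Set.Icc l u := by
    intro p
    rw [ae_iff, hμ, PMF.toMeasure_apply_eq_zero_iff _ (MeasurableSet.of_discrete)]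
    rw [PMF.support_uniformOfFinset, Set.disjoint_left]
    intro x hx hx'
    exact hx' (hg _ x hx)
  have hint : ∀ p, ∫ x, g x ∂(μ p) = (∑ x ∈ D p.1, g x) / (D p.1).card := fun p =>
    aux_integral _ _ _ (Integrable.of_mem_Icc l u hmeas.aemeasurable (hae p))
  have hsub : ∀ p, ProbabilityTheory.HasSubgaussianMGF
      (fun ω : Fin K × Fin N → γ => g (ω p) - ∫ x, g x ∂(μ p)) ((‖u - l‖₊ / 2) ^ 2)
      (Measure.pi μ) := by
    intro p
    have h := ProbabilityTheory.hasSubgaussianMGF_of_mem_Icc hmeas.aemeasurable (hae p)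
    have mp := measurePreserving_eval μ p
    rw [← mp.map_eq] at h
    have h2 := ProbabilityTheory.HasSubgaussianMGF.of_map mp.measurable.aemeasurable h
    rw [mp.map_eq] at h2
    exact h2
  have hind := ProbabilityTheory.iIndepFun_pi (μ := μ)
    (X := fun p x => g x - ∫ x, g x ∂(μ p)) (fun p => (hmeas.sub_const _).aemeasurable)
  have hind2 := hind.precomp (g := fun i : Fin N => (j, i)) (fun a b h => by simpa using h)
  have hN' : (0 : ℝ) < N := by exact_mod_cast hN
  have key := ProbabilityTheory.HasSubgaussianMGF.measure_sum_ge_le_of_iIndepFun hind2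
    (s := Finset.univ) (fun i _ => hsub (j, i)) (ε := N * ε) (by positivity)
  refine le_trans (le_of_eq ?_) (key.trans (le_of_eq ?_))
  · congr 1
    ext ω
    simp only [Set.mem_setOf_eq, hint, Finset.sum_sub_distrib, Finset.sum_const,
      Finset.card_univ, Fintype.card_fin, nsmul_eq_mul]
    rw [le_div_iff₀ hN']
    constructor <;> intro h <;> linarith
  · rw [hlu]
    congr 1
    simp
    field_simp

lemma aux_avg_ge {γ : Type*} [DecidableEq γ] {K : ℕ} (D : Fin K → Finset γ)
    (hD : ∀ j, (D j).Nonempty)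
    (hdisj : ∀ i j, i ≠ j → Disjoint (D i) (D j)) (f : γ → ℝ) (S : Finset (Fin K)) (c : ℝ)
    (h : ∀ j ∈ S, c ≤ (∑ x ∈ D j, f x) / (D j).card) (hne : (S.biUnion D).Nonempty) :
    c ≤ (∑ x ∈ S.biUnion D, f x) / (S.biUnion D).card := by
  have hc : (0 : ℝ) < (S.biUnion D).card := by exact_mod_cast hne.card_pos
  have hpd : (S : Set (Fin K)).PairwiseDisjoint D := fun i _ j _ hij => hdisj i j hij
  rw [le_div_iff₀ hc, Finset.sum_biUnion hpd, Finset.card_biUnion hpd, Nat.cast_sum,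
    Finset.mul_sum]
  refine Finset.sum_le_sum fun j hj => ?_
  have : (0 : ℝ) < (D j).card := by exact_mod_cast (hD j).card_pos
  exact (le_div_iff₀ this).1 (h j hj)

lemma aux_map {γ' γ ι : Type*} [Fintype ι] [MeasurableSpace γ'] [MeasurableSpace γ]
    (e : γ' → γ) (he : Measurable e) (p : ι → PMF γ') (S : Set (ι → γ)) :
    Measure.pi (fun i => (p i).toMeasure) ((fun (x : ι → γ') i => e (x i)) ⁻¹' S) ≤
      Measure.pi (fun i => ((p i).map e).toMeasure) S := by
  have hmap : ∀ i, (p i).toMeasure.map e = ((p i).map e).toMeasure :=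
    fun i => PMF.toMeasure_map _ (p i) he
  have hsf : ∀ i, SigmaFinite ((p i).toMeasure.map e) := by
    intro i; rw [hmap]; infer_instance
  have h := Measure.pi_map_pi (μ := fun i => (p i).toMeasure) (f := fun _ => e)
    (fun i => he.aemeasurable)
  simp only [hmap] at h
  rw [← h]
  exact Measure.le_map_apply (Measurable.aemeasurable (by fun_prop)) S

lemma aux_change {γ ι : Type*} [Fintype ι] [m : MeasurableSpace γ] (p : ι → PMF γ)
    (S : Set (ι → γ)) :
    @Measure.pi ι (fun _ => γ) _ (fun _ => ⊤) (fun i => @PMF.toMeasure γ ⊤ (p i)) S ≤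
      Measure.pi (fun i => (p i).toMeasure) S := by
  have h := @aux_map γ γ ι _ ⊤ m id (fun s _ => trivial) p S
  simp only [PMF.map_id] at h
  exact h

/-- Let `X` be a nonempty finite set, `f : X → [0,1]`, and let
`D 0, …, D (K-1)` be nonempty pairwise disjoint subsets of `X` whose union is `X`.
Fix thresholds `a, b ∈ [0,1]`, a positive integer `N`, and `δ ∈ (0,1)`.  For each `j`
draw `N` independent uniform samples from `D j` (all `K·N` draws independent, modelled
by the product measure indexed by `Fin K × Fin N`), and let
`fhat j ω = (1/N) ∑ i, f (ω (j,i))` be the empirical mean on `D j`.  Define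
`Xkeep ω = ⋃ {D j : fhat j ω ≥ 1 − b}` and `Xdisc ω = ⋃ {D j : fhat j ω ≤ a}`.  Then
with probability at least `1 − δ`: if `Xkeep ω` is nonempty then
`f̄(Xkeep ω) ≥ 1 − b − √(log(2K/δ)/(2N))`, and if `Xdisc ω` is nonempty then
`f̄(Xdisc ω) ≤ a + √(log(2K/δ)/(2N))`. -/
theorem stmt4 {γ : Type*} [MeasurableSpace γ] [DecidableEq γ]
    (X : Finset γ) (hX : X.Nonempty)
    (f : γ → ℝ) (hf : ∀ x ∈ X, f x ∈ Set.Icc (0 : ℝ) 1)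
    (K : ℕ) (hK : 0 < K) (D : Fin K → Finset γ) (hD : ∀ j, (D j).Nonempty)
    (hdisj : ∀ i j, i ≠ j → Disjoint (D i) (D j))
    (hunion : Finset.univ.biUnion D = X)
    (a b : ℝ) (ha : a ∈ Set.Icc (0 : ℝ) 1) (hb : b ∈ Set.Icc (0 : ℝ) 1)
    (N : ℕ) (hN : 0 < N) (δ : ℝ) (hδ : δ ∈ Set.Ioo (0 : ℝ) 1) :
    ENNReal.ofReal (1 - δ) ≤
      (Measure.pi fun p : Fin K × Fin N => (PMF.uniformOfFinset (D p.1) (hD p.1)).toMeasure)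
        {ω : Fin K × Fin N → γ |
          (((Finset.univ.filter
                (fun j : Fin K => 1 - b ≤ (∑ i : Fin N, f (ω (j, i))) / N)).biUnion
              D).Nonempty →
            1 - b - Real.sqrt (Real.log (2 * K / δ) / (2 * N)) ≤
              (∑ x ∈ (Finset.univ.filter
                  (fun j : Fin K => 1 - b ≤ (∑ i : Fin N, f (ω (j, i))) / N)).biUnion D, f x) /
                ((Finset.univ.filter
                  (fun j : Fin K => 1 - b ≤ (∑ i : Fin N, f (ω (j, i))) / N)).biUnion D).card) ∧
          (((Finset.univ.filter
                (fun j : Fin K => (∑ i : Fin N, f (ω (j, i))) / N ≤ a)).biUnion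
              D).Nonempty →
            (∑ x ∈ (Finset.univ.filter
                (fun j : Fin K => (∑ i : Fin N, f (ω (j, i))) / N ≤ a)).biUnion D, f x) /
              ((Finset.univ.filter
                (fun j : Fin K => (∑ i : Fin N, f (ω (j, i))) / N ≤ a)).biUnion D).card ≤
              a + Real.sqrt (Real.log (2 * K / δ) / (2 * N)))} := by
  refine le_trans ?_ (aux_change (fun p : Fin K × Fin N => PMF.uniformOfFinset (D p.1) (hD p.1)) _)
  letI : MeasurableSpace γ := ⊤
  haveI : DiscreteMeasurableSpace γ := ⟨fun _ => trivial⟩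
  set ε := Real.sqrt (Real.log (2 * K / δ) / (2 * N)) with hεdef
  have hε : 0 ≤ ε := Real.sqrt_nonneg _
  have hN' : (0 : ℝ) < N := by exact_mod_cast hN
  have hK' : (1 : ℝ) ≤ K := by exact_mod_cast hK
  have hδ0 := hδ.1
  have hδ1 := hδ.2
  have hexp : Real.exp (-(2 * N * ε ^ 2)) = δ / (2 * K) := by
    have h1 : 1 ≤ 2 * K / δ := by rw [le_div_iff₀ hδ0]; linarith
    have h2 : 0 ≤ Real.log (2 * K / δ) / (2 * N) := div_nonneg (Real.log_nonneg h1) (by positivity)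
    rw [hεdef, Real.sq_sqrt h2, mul_div_cancel₀ _ (by positivity), Real.exp_neg,
      Real.exp_log (by positivity), inv_div]
  have hfD : ∀ j, ∀ x ∈ D j, f x ∈ Set.Icc (0 : ℝ) 1 := fun j x hx =>
    hf x (hunion ▸ Finset.mem_biUnion.2 ⟨j, Finset.mem_univ _, hx⟩)
  have hA := fun j => aux_hoeff K N hN D hD f 0 1 (by norm_num) hfD j ε hε
  have hB := fun j => aux_hoeff K N hN D hD (fun x => - f x) (-1) 0 (by norm_num)
    (fun j x hx => ⟨by linarith [(hfD j x hx).2], by linarith [(hfD j x hx).1]⟩) j ε hε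
  simp only [hexp] at hA hB
  set P : Measure (Fin K × Fin N → γ) := Measure.pi fun p : Fin K × Fin N =>
    (PMF.uniformOfFinset (D p.1) (hD p.1)).toMeasure with hP
  haveI : IsProbabilityMeasure P := by rw [hP]; infer_instance
  set A : Fin K → Set (Fin K × Fin N → γ) := fun j =>
    {ω | (∑ x ∈ D j, f x) / (D j).card + ε ≤ (∑ i : Fin N, f (ω (j, i))) / N} with hAd
  set B : Fin K → Set (Fin K × Fin N → γ) := fun j =>
    {ω | (∑ x ∈ D j, - f x) / (D j).card + ε ≤ (∑ i : Fin N, - f (ω (j, i))) / N} with hBd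
  have hbad : P.real (⋃ j, (A j ∪ B j)) ≤ δ := by
    calc P.real (⋃ j, (A j ∪ B j)) ≤ ∑ j, P.real (A j ∪ B j) := measureReal_iUnion_fintype_le _
      _ ≤ ∑ j : Fin K, (δ / (2 * K) + δ / (2 * K)) := Finset.sum_le_sum fun j _ =>
          (measureReal_union_le _ _).trans (add_le_add (hA j) (hB j))
      _ = δ := by
          simp only [Finset.sum_const, Finset.card_univ, Fintype.card_fin, nsmul_eq_mul]
          field_simp
          norm_num
  have hgood : 1 - δ ≤ P.real (⋃ j, (A j ∪ B j))ᶜ := by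
    have h := measureReal_union_le (μ := P) (⋃ j, (A j ∪ B j)) (⋃ j, (A j ∪ B j))ᶜ
    rw [Set.union_compl_self, probReal_univ] at h
    linarith
  refine (ENNReal.ofReal_le_of_le_toReal hgood).trans (measure_mono ?_)
  intro ω hω
  simp only [Set.mem_compl_iff, Set.mem_iUnion, Set.mem_union, not_exists, not_or, hAd, hBd,
    Set.mem_setOf_eq, not_le, Finset.sum_neg_distrib, neg_div] at hω
  refine ⟨fun hne => ?_, fun hne => ?_⟩
  · refine aux_avg_ge D hD hdisj f _ _ (fun j hj => ?_) hne
    have h1 := (Finset.mem_filter.1 hj).2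
    linarith [(hω j).1]
  · have h := aux_avg_ge D hD hdisj (fun x => - f x) _ (-(a + ε)) (fun j hj => ?_) hne
    · rw [Finset.sum_neg_distrib, neg_div] at h
      exact neg_le_neg_iff.1 h
    · have h1 := (Finset.mem_filter.1 hj).2
      rw [Finset.sum_neg_distrib, neg_div]
      linarith [(hω j).2]
end

section
/- Let (V, ≤) be a finite tree order in which every non-leaf element has at least two children, and let A ⊆ V be an antichain such that every leaf ℓ satisfies ℓ ≤ a for some a ∈ A. Let f be a [0,1]-valued function on the leaves, and for v ∈ V let f̄(v) denote the average of f over the leaves ℓ with ℓ ≤ v. Fix ε ≥ 0 and α', β', α, β ∈ [0,1] with α ≥ α' + ε and β ≥ β' + ε, suppose that every a ∈ A satisfies f̄(a) ≤ α' or f̄(a) ≥ 1 − β', and suppose f̂ : V → ℝ satisfies |f̂(v) − f̄(v)| ≤ ε for all v ∈ V. Define the visited set S = {v ∈ V : every w ∈ V with v < w satisfies α < f̂(w) < 1 − β}. Then every v ∈ S satisfies a ≤ v for some a ∈ A, and consequently |S| ≤ 2|A| − 1. -/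
open Classical in
/-- `leafAvg f v` is the average of `f` over the leaves (minimal elements) `ℓ` with
`ℓ ≤ v` in a finite partial order. -/
noncomputable def leafAvg {V : Type*} [Fintype V] [PartialOrder V] (f : V → ℝ) (v : V) :
    ℝ :=
  (∑ ℓ ∈ Finset.univ.filter (fun ℓ : V => IsMin ℓ ∧ ℓ ≤ v), f ℓ) /
    (Finset.univ.filter (fun ℓ : V => IsMin ℓ ∧ ℓ ≤ v)).card

/-- Let `(V, ≤)` be a finite tree order (a finite partial order with a
greatest element—the root—in which every up-set `{w | v ≤ w}` is a chain), in which
every non-leaf (non-minimal) element has at least two children (elements covered by it),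
and let `A ⊆ V` be an antichain such that every leaf is below some element of `A`.
Let `f` be `[0,1]`-valued on the leaves, and let `f̄(v)` be the average of `f` over the
leaves below `v`.  Fix `ε ≥ 0` and `a', b', a, b ∈ [0,1]` with `a ≥ a' + ε` and
`b ≥ b' + ε`; suppose each `x ∈ A` satisfies `f̄(x) ≤ a'` or `f̄(x) ≥ 1 − b'`, and that
`fhat : V → ℝ` satisfies `|fhat v − f̄(v)| ≤ ε` for all `v`.  Define the visited set
`S = {v | ∀ w, v < w → a < fhat w < 1 − b}`.  Then every `v ∈ S` is weakly above some
element of `A`, and consequently `|S| ≤ 2|A| − 1`. -/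
theorem stmt8 {V : Type*} [Fintype V] [PartialOrder V] [OrderTop V]
    (hchain : ∀ v : V, IsChain (· ≤ ·) {w : V | v ≤ w})
    (hchild : ∀ v : V, ¬ IsMin v → ∃ u₁ u₂ : V, u₁ ≠ u₂ ∧ u₁ ⋖ v ∧ u₂ ⋖ v)
    (A : Set V) (hA : IsAntichain (· ≤ ·) A)
    (hcover : ∀ ℓ : V, IsMin ℓ → ∃ x ∈ A, ℓ ≤ x)
    (f : V → ℝ) (hf : ∀ ℓ : V, IsMin ℓ → f ℓ ∈ Set.Icc (0 : ℝ) 1)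
    (ε : ℝ) (hε : 0 ≤ ε)
    (a' b' a b : ℝ)
    (ha' : a' ∈ Set.Icc (0 : ℝ) 1) (hb' : b' ∈ Set.Icc (0 : ℝ) 1)
    (ha : a ∈ Set.Icc (0 : ℝ) 1) (hb : b ∈ Set.Icc (0 : ℝ) 1)
    (haa : a' + ε ≤ a) (hbb : b' + ε ≤ b)
    (hpure : ∀ x ∈ A, leafAvg f x ≤ a' ∨ 1 - b' ≤ leafAvg f x)
    (fhat : V → ℝ) (hfhat : ∀ v : V, |fhat v - leafAvg f v| ≤ ε) :
    (∀ v ∈ {v : V | ∀ w : V, v < w → a < fhat w ∧ fhat w < 1 - b},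
        ∃ x ∈ A, x ≤ v) ∧
    Nat.card {v : V | ∀ w : V, v < w → a < fhat w ∧ fhat w < 1 - b} ≤
      2 * Nat.card A - 1 := by
  classical
  have hleaf : ∀ v : V, ∃ l : V, IsMin l ∧ l ≤ v := by
    intro v
    obtain ⟨l, hl, hm⟩ := (Set.toFinite {w : V | w ≤ v}).exists_le_minimal (a := v) (le_refl v)
    refine ⟨l, ?_, hl⟩
    intro w hw
    exact hm.2 (show w ≤ v from hw.trans hl) hw
  have hcomp : ∀ l x y : V, l ≤ x → l ≤ y → x ≤ y ∨ y ≤ x := by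
    intro l x y hx hy
    exact (hchain l).total hx hy
  have h1 : ∀ v ∈ {v : V | ∀ w : V, v < w → a < fhat w ∧ fhat w < 1 - b},
      ∃ x ∈ A, x ≤ v := by
    intro v hv
    obtain ⟨l, hl, hlv⟩ := hleaf v
    obtain ⟨x, hx, hlx⟩ := hcover l hl
    refine ⟨x, hx, ?_⟩
    by_contra hn
    have hvx : v < x := by
      rcases hcomp l x v hlx hlv with h | h
      · exact absurd h hn
      · exact lt_of_le_not_ge h hn
    have h2 := hv x hvx
    have h3 := abs_le.1 (hfhat x)
    rcases hpure x hx with h | h <;> linarith [h2.1, h2.2, h3.1, h3.2]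
  refine ⟨h1, ?_⟩
  have hanti : ∀ x ∈ A, ∀ y ∈ A, x ≤ y → x = y := by
    intro x hx y hy hxy
    exact hA.eq hx hy hxy
  have hTchild : ∀ v : V, v ∉ A → (∃ x ∈ A, x ≤ v) → ∀ u, u ⋖ v → ∃ x ∈ A, x ≤ u := by
    rintro v hvA ⟨x, hx, hxv⟩ u huv
    obtain ⟨l, hl, hlu⟩ := hleaf u
    obtain ⟨y, hy, hly⟩ := hcover l hl
    refine ⟨y, hy, ?_⟩
    have hyv : y ≤ v := by
      rcases hcomp l y v hly (hlu.trans huv.le) with h | h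
      · exact h
      · have := hanti x hx y hy (hxv.trans h)
        subst this
        exact hxv
    rcases hcomp l y u hly hlu with h | h
    · exact h
    · rcases huv.eq_or_eq h hyv with h | h
      · exact h.le
      · exact absurd (h ▸ hy) hvA
  let T : Finset V := Finset.univ.filter (fun v => ∃ x ∈ A, x ≤ v)
  let N : Finset V := T.filter (fun v => v ∉ A)
  let AF : Finset V := T.filter (fun v => v ∈ A)
  have hAF : Nat.card A = AF.card := by
    rw [Nat.card_coe_set_eq, ← Set.ncard_coe_finset]
    congr 1
    ext v
    simp only [AF, T, Finset.coe_filter, Finset.mem_filter, Finset.mem_univ, true_and,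
      Set.mem_setOf_eq]
    exact ⟨fun h => ⟨⟨v, h, le_refl v⟩, h⟩, fun h => h.2⟩
  have hS : Nat.card {v : V | ∀ w : V, v < w → a < fhat w ∧ fhat w < 1 - b} ≤ T.card := by
    rw [Nat.card_coe_set_eq, ← Set.ncard_coe_finset]
    apply Set.ncard_le_ncard _ (Finset.finite_toSet T)
    intro v hv
    simpa [T] using h1 v hv
  have hsum : AF.card + N.card = T.card := Finset.card_filter_add_card_filter_not _
  have hNmin : ∀ v ∈ N, ¬ IsMin v := by
    intro v hv hm
    simp only [N, T, Finset.mem_filter, Finset.mem_univ, true_and] at hv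
    obtain ⟨⟨x, hx, hxv⟩, hvA⟩ := hv
    have : x = v := le_antisymm hxv (hm hxv)
    exact hvA (this ▸ hx)
  have hc : ∀ v : V, ∃ c : Bool → V, v ∈ N → c true ≠ c false ∧ ∀ i, c i ⋖ v := by
    intro v
    by_cases hv : v ∈ N
    · obtain ⟨u₁, u₂, hne, hu₁, hu₂⟩ := hchild v (hNmin v hv)
      refine ⟨fun i => if i then u₁ else u₂, fun _ => ⟨by simpa using hne, ?_⟩⟩
      intro i
      cases i <;> simpa
    · exact ⟨fun _ => v, fun h => absurd h hv⟩
  choose c hc using hc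
  have htop : (⊤ : V) ∈ T := by
    obtain ⟨l, hl, -⟩ := hleaf (⊤ : V)
    obtain ⟨x, hx, -⟩ := hcover l hl
    simp only [T, Finset.mem_filter, Finset.mem_univ, true_and]
    exact ⟨x, hx, le_top⟩
  have hcard : (N ×ˢ (Finset.univ : Finset Bool)).card ≤ (T.erase ⊤).card := by
    apply Finset.card_le_card_of_injOn (fun p => c p.1 p.2)
    · rintro ⟨v, i⟩ hp
      have hv : v ∈ N := by simpa using hp
      have hcv := (hc v hv).2 i
      simp only [Finset.coe_erase, Set.mem_diff, Finset.mem_coe, Set.mem_singleton_iff]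
      have hv2 := hv
      simp only [N, T, Finset.mem_filter, Finset.mem_univ, true_and] at hv2
      refine ⟨?_, (hcv.lt.trans_le le_top).ne⟩
      simp only [T, Finset.mem_filter, Finset.mem_univ, true_and]
      exact hTchild v hv2.2 hv2.1 _ hcv
    · rintro ⟨v, i⟩ hp ⟨w, j⟩ hq heq
      have hv : v ∈ N := by simpa using hp
      have hw : w ∈ N := by simpa using hq
      have hcv := (hc v hv).2 i
      have hcw := (hc w hw).2 j
      simp only at heq
      rw [← heq] at hcw
      have hvw : v = w := by
        rcases hcomp _ v w hcv.le hcw.le with h | h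
        · rcases hcw.eq_or_eq hcv.le h with h | h
          · exact absurd h hcv.lt.ne'
          · exact h
        · rcases hcv.eq_or_eq hcw.le h with h | h
          · exact absurd h hcw.lt.ne'
          · exact h.symm
      subst hvw
      have hne := (hc v hv).1
      cases i <;> cases j <;> simp_all
  rw [Finset.card_product, Finset.card_erase_of_mem htop] at hcard
  simp only [Finset.card_univ, Fintype.card_bool] at hcard
  have hTpos : 0 < T.card := Finset.card_pos.2 ⟨_, htop⟩
  omega
end
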